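/- arXiv:math/0604061 — 2 statements merged into one kernel-verified Lean document; each statement's English description precedes it below -/
import Mathlib

section
/- Let G be a Garside group with Garside element Δ and N = ‖Δ‖. For every element g of G, the following are equivalent: (i) g is sup-straight, i.e. sup(g) = t_sup(g); (ii) sup(g^N) = N·sup(g); (iii) sup(g^k) = k·sup(g) for every integer k ≥ 1. -/
open Filter Topology Pointwise

/-- Left divisibility order on a group relative to a submonoid `P` of positive elements:
`a ≤_L b` iff `a⁻¹ * b ∈ P`. -/
def leL {G : Type*} [Group G] (P : Submonoid G) (a b : G) : Prop := a⁻¹ * b ∈ P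

/-- Right divisibility order: `a ≤_R b` iff `b * a⁻¹ ∈ P`. -/
def leR {G : Type*} [Group G] (P : Submonoid G) (a b : G) : Prop := b * a⁻¹ ∈ P

/-- An atom of the positive monoid `P`: a nontrivial element admitting no nontrivial
factorization inside `P`. -/
def IsMonAtom {G : Type*} [Group G] (P : Submonoid G) (a : G) : Prop :=
  a ∈ P ∧ a ≠ 1 ∧ ∀ b c : G, b ∈ P → c ∈ P → a = b * c → b = 1 ∨ c = 1

/-- `a` can be written as a product of `n` atoms of `P`. -/
def IsAtomProd {G : Type*} [Group G] (P : Submonoid G) (n : ℕ) (a : G) : Prop :=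
  ∃ l : List G, l.length = n ∧ (∀ x ∈ l, IsMonAtom P x) ∧ l.prod = a

/-- A Garside structure on a group `G`: `G` is the group of fractions of the positive
monoid `P`, which is a finitely generated atomic monoid (with atomic norm `norm`),
a lattice for both `≤_L` and `≤_R`, equipped with a Garside element `Δ` whose left and
right divisors coincide and generate `P`.  The fields `zinf`, `zsup`, `infs`, `sups`,
`tinf`, `tsup` are the (uniquely determined) invariants
`inf g = max {r : Δ^r ≤_L g}`, `sup g = min {s : g ≤_L Δ^s}`,
`inf_s g = max {inf h : h ∈ [g]}`, `sup_s g = min {sup h : h ∈ [g]}`,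
`t_inf g = lim inf(gⁿ)/n` and `t_sup g = lim sup(gⁿ)/n`,
each given together with its defining specification. -/
structure GarsideGroup (G : Type*) [Group G] where
  P : Submonoid G
  /-- `G` is the group of fractions of `P`. -/
  fraction : ∀ g : G, ∃ a b : G, a ∈ P ∧ b ∈ P ∧ g = a⁻¹ * b
  /-- `P` is finitely generated. -/
  fg : P.FG
  /-- the atomic norm `‖·‖` -/
  norm : G → ℕ
  /-- `P` is atomic: every positive element is a product of atoms and `norm a` is the
  greatest length of such an expression. -/
  norm_spec : ∀ a ∈ P, IsGreatest {n : ℕ | IsAtomProd P n a} (norm a)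
  /-- `(P, ≤_L)` is a lattice: gcd's and lcm's exist. -/
  latticeL : ∀ a ∈ P, ∀ b ∈ P,
    (∃ c ∈ P, leL P c a ∧ leL P c b ∧ ∀ d ∈ P, leL P d a → leL P d b → leL P d c) ∧
    (∃ c ∈ P, leL P a c ∧ leL P b c ∧ ∀ d ∈ P, leL P a d → leL P b d → leL P c d)
  /-- `(P, ≤_R)` is a lattice. -/
  latticeR : ∀ a ∈ P, ∀ b ∈ P,
    (∃ c ∈ P, leR P c a ∧ leR P c b ∧ ∀ d ∈ P, leR P d a → leR P d b → leR P d c) ∧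
    (∃ c ∈ P, leR P a c ∧ leR P b c ∧ ∀ d ∈ P, leR P a d → leR P b d → leR P c d)
  /-- the Garside element -/
  Δ : G
  Δ_mem : Δ ∈ P
  /-- the left and right divisors of `Δ` coincide -/
  Δ_balanced : ∀ a ∈ P, (leL P a Δ ↔ leR P a Δ)
  /-- the simple elements generate `P` -/
  simples_gen : Submonoid.closure {a : G | a ∈ P ∧ leL P a Δ} = P
  /-- `inf g = max {r : ℤ | Δ^r ≤_L g}` -/
  zinf : G → ℤ
  /-- `sup g = min {s : ℤ | g ≤_L Δ^s}` -/
  zsup : G → ℤ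
  zinf_spec : ∀ g : G, IsGreatest {r : ℤ | leL P (Δ ^ r) g} (zinf g)
  zsup_spec : ∀ g : G, IsLeast {s : ℤ | leL P g (Δ ^ s)} (zsup g)
  /-- `inf_s g = max {inf h : h ∈ [g]}` -/
  infs : G → ℤ
  /-- `sup_s g = min {sup h : h ∈ [g]}` -/
  sups : G → ℤ
  infs_spec : ∀ g : G, IsGreatest (Set.range fun h : G => zinf (h⁻¹ * g * h)) (infs g)
  sups_spec : ∀ g : G, IsLeast (Set.range fun h : G => zsup (h⁻¹ * g * h)) (sups g)
  /-- `t_inf g = lim_{n → ∞} inf(gⁿ)/n` -/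
  tinf : G → ℝ
  /-- `t_sup g = lim_{n → ∞} sup(gⁿ)/n` -/
  tsup : G → ℝ
  tinf_spec : ∀ g : G,
    Filter.Tendsto (fun n : ℕ => (zinf (g ^ n) : ℝ) / (n : ℝ)) Filter.atTop (nhds (tinf g))
  tsup_spec : ∀ g : G,
    Filter.Tendsto (fun n : ℕ => (zsup (g ^ n) : ℝ) / (n : ℝ)) Filter.atTop (nhds (tsup g))

namespace GarsideGroup

variable {G : Type*} [Group G] (Γ : GarsideGroup G)

/-- The set `𝒟` of simple elements. -/
def simples : Set G := {a : G | a ∈ Γ.P ∧ leL Γ.P a Γ.Δ}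

/-- `len g = sup g - inf g` -/
def len (g : G) : ℤ := Γ.zsup g - Γ.zinf g

/-- `t_len g = t_sup g - t_inf g` -/
noncomputable def tlen (g : G) : ℝ := Γ.tsup g - Γ.tinf g

/-- `g` is inf-straight if `inf g = t_inf g`. -/
def InfStraight (g : G) : Prop := (Γ.zinf g : ℝ) = Γ.tinf g

/-- `g` is sup-straight if `sup g = t_sup g`. -/
def SupStraight (g : G) : Prop := (Γ.zsup g : ℝ) = Γ.tsup g

/-- The super summit set `[g]^S`. -/
def superSummit (g : G) : Set G :=
  {h : G | (∃ x : G, x⁻¹ * g * x = h) ∧ Γ.zinf h = Γ.infs g ∧ Γ.zsup h = Γ.sups g}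

end GarsideGroup

/-- The shortest length of a word over the alphabet `X` representing `g`. -/
noncomputable def wlen {G : Type*} [Group G] (X : Set G) (g : G) : ℕ :=
  sInf {n : ℕ | ∃ l : List G, l.length = n ∧ (∀ x ∈ l, x ∈ X) ∧ l.prod = g}

namespace GarsideGroup

variable {G : Type*} [Group G] (Γ : GarsideGroup G)

theorem norm_mul_ge (a b : G) (ha : a ∈ Γ.P) (hb : b ∈ Γ.P) :
    Γ.norm a + Γ.norm b ≤ Γ.norm (a * b) := by
  obtain ⟨l, hl, hl', hl''⟩ := (Γ.norm_spec a ha).1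
  obtain ⟨m, hm, hm', hm''⟩ := (Γ.norm_spec b hb).1
  refine (Γ.norm_spec (a * b) (Γ.P.mul_mem ha hb)).2 ⟨l ++ m, by simp [hl, hm], ?_, by simp [hl'', hm'']⟩
  intro x hx
  rcases List.mem_append.1 hx with h | h
  · exact hl' x h
  · exact hm' x h

theorem norm_pos_of_ne (b : G) (hb : b ∈ Γ.P) (h1 : b ≠ 1) : 1 ≤ Γ.norm b := by
  obtain ⟨m, hm, hm', hm''⟩ := (Γ.norm_spec b hb).1
  by_contra h
  have : m.length = 0 := by omega
  rw [List.length_eq_zero_iff] at this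
  subst this
  exact h1 (by simpa using hm''.symm)

theorem conj_mem (x : G) (hx : x ∈ Γ.P) : Γ.Δ⁻¹ * x * Γ.Δ ∈ Γ.P := by
  rw [← Γ.simples_gen] at hx
  induction hx using Submonoid.closure_induction with
  | mem a ha =>
    obtain ⟨ha, hd⟩ := ha
    have h2 : leR Γ.P (a⁻¹ * Γ.Δ) Γ.Δ := by
      have : Γ.Δ * (a⁻¹ * Γ.Δ)⁻¹ = a := by group
      unfold leR; rwa [this]
    have h3 := (Γ.Δ_balanced _ hd).2 h2
    have : (a⁻¹ * Γ.Δ)⁻¹ * Γ.Δ = Γ.Δ⁻¹ * a * Γ.Δ := by group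
    unfold leL at h3; rwa [this] at h3
  | one => simpa using Γ.P.one_mem
  | mul a b _ _ iha ihb =>
    have := Γ.P.mul_mem iha ihb
    convert this using 1; group

theorem conj_mem' (x : G) (hx : x ∈ Γ.P) : Γ.Δ * x * Γ.Δ⁻¹ ∈ Γ.P := by
  rw [← Γ.simples_gen] at hx
  induction hx using Submonoid.closure_induction with
  | mem a ha =>
    obtain ⟨ha, hd⟩ := ha
    have h1 : Γ.Δ * a⁻¹ ∈ Γ.P := (Γ.Δ_balanced a ha).1 hd
    have h2 : leL Γ.P (Γ.Δ * a⁻¹) Γ.Δ := by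
      have : (Γ.Δ * a⁻¹)⁻¹ * Γ.Δ = a := by group
      unfold leL; rwa [this]
    have h3 := (Γ.Δ_balanced _ h1).1 h2
    have : Γ.Δ * (Γ.Δ * a⁻¹)⁻¹ = Γ.Δ * a * Γ.Δ⁻¹ := by group
    unfold leR at h3; rwa [this] at h3
  | one => simpa using Γ.P.one_mem
  | mul a b _ _ iha ihb =>
    have := Γ.P.mul_mem iha ihb
    convert this using 1; group

theorem conj_zpow (n : ℤ) : ∀ x ∈ Γ.P, Γ.Δ ^ n * x * Γ.Δ ^ (-n) ∈ Γ.P := by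
  induction n using Int.induction_on with
  | zero => intro x hx; simpa using hx
  | succ i ih =>
    intro x hx
    have := Γ.conj_mem' _ (ih x hx)
    convert this using 1; group
  | pred i ih =>
    intro x hx
    have := Γ.conj_mem _ (ih x hx)
    convert this using 1; group

theorem lel_trans {a b c : G} (h1 : leL Γ.P a b) (h2 : leL Γ.P b c) : leL Γ.P a c := by
  have := Γ.P.mul_mem h1 h2
  unfold leL; convert this using 1; group

theorem step (s : ℤ) (a p q : G) (ha : a ∈ Γ.P) (hq : q ∈ Γ.P)
    (H : ∀ x ∈ Γ.P, leL Γ.P x Γ.Δ → leL Γ.P x q → leL Γ.P x p) :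
    ∀ x ∈ Γ.P, leL Γ.P x Γ.Δ → leL Γ.P x (a * (Γ.Δ ^ (-s) * q * Γ.Δ ^ s)) →
      leL Γ.P x (a * (Γ.Δ ^ (-s) * p * Γ.Δ ^ s)) := by
  intro x hx hxd hxq
  obtain ⟨y, hy, hxy, hay, hmin⟩ := (Γ.latticeL x hx a ha).2
  have hq' : Γ.Δ ^ (-s) * q * Γ.Δ ^ s ∈ Γ.P := by
    have := Γ.conj_zpow (-s) q hq
    simpa using this
  have h1 : leL Γ.P y (a * (Γ.Δ ^ (-s) * q * Γ.Δ ^ s)) := by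
    apply hmin _ (Γ.P.mul_mem ha hq') hxq
    unfold leL; simpa using hq'
  have h2 : leL Γ.P y (a * Γ.Δ) := by
    apply hmin _ (Γ.P.mul_mem ha Γ.Δ_mem)
    · refine Γ.lel_trans hxd ?_
      have := Γ.conj_mem a ha
      unfold leL; convert this using 1; group
    · unfold leL; simpa using Γ.Δ_mem
  have h3 := H (Γ.Δ ^ s * (a⁻¹ * y) * Γ.Δ ^ (-s)) (Γ.conj_zpow s _ hay) (by
    have := Γ.conj_zpow s _ h2
    unfold leL; convert this using 1; group) (by
    have := Γ.conj_zpow s _ h1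
    unfold leL; convert this using 1; group)
  refine Γ.lel_trans hxy ?_
  have := Γ.conj_zpow (-s) _ h3
  unfold leL; convert this using 1; group

theorem main_div (s : ℤ) (a : G) (ha : a ∈ Γ.P) (p : ℕ → G) (hp : ∀ k, p k ∈ Γ.P)
    (hs : ∀ k, p (k + 1) = a * (Γ.Δ ^ (-s) * p k * Γ.Δ ^ s))
    (hm : ∀ k, leL Γ.P (p k) (p (k + 1))) (j : ℕ) (hj : leL Γ.P Γ.Δ (p j)) :
    leL Γ.P Γ.Δ (p (Γ.norm Γ.Δ)) := by
  have hmono : ∀ k, leL Γ.P Γ.Δ (p k) → ∀ i, leL Γ.P Γ.Δ (p (k + i)) := by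
    intro k hk i
    induction i with
    | zero => exact hk
    | succ i ih => exact Γ.lel_trans ih (hm _)
  have hQ : ∀ k, (∀ x ∈ Γ.P, leL Γ.P x Γ.Δ → leL Γ.P x (p (k+1)) → leL Γ.P x (p k)) →
      ∀ i, (∀ x ∈ Γ.P, leL Γ.P x Γ.Δ → leL Γ.P x (p (k+i)) → leL Γ.P x (p k)) := by
    intro k hk
    have hst : ∀ i, (∀ x ∈ Γ.P, leL Γ.P x Γ.Δ → leL Γ.P x (p (k+i+1)) → leL Γ.P x (p (k+i))) := by
      intro i
      induction i with
      | zero => exact hk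
      | succ i ih =>
        have := Γ.step s a _ _ ha (hp _) ih
        rw [← hs, ← hs] at this
        exact this
    intro i
    induction i with
    | zero => intro x _ _ h; exact h
    | succ i ih => intro x hx hd h; exact ih x hx hd (hst i x hx hd h)
  have hrefl : leL Γ.P Γ.Δ Γ.Δ := by unfold leL; simpa using Γ.P.one_mem
  have key : ∀ k, leL Γ.P Γ.Δ (p k) ∨
      ∃ x ∈ Γ.P, leL Γ.P x Γ.Δ ∧ leL Γ.P x (p k) ∧ k ≤ Γ.norm x := by
    intro k
    induction k with
    | zero =>
      right
      exact ⟨1, Γ.P.one_mem, by simpa [leL] using Γ.Δ_mem, by simpa [leL] using hp 0, Nat.zero_le _⟩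
    | succ k ih =>
      rcases ih with h | ⟨x, hx, hxd, hxp, hn⟩
      · left; exact hmono k h 1
      obtain ⟨d, hd, hdp, hdd, hdm⟩ := (Γ.latticeL (p (k+1)) (hp _) Γ.Δ Γ.Δ_mem).1
      have hxd' := hdm x hx (Γ.lel_trans hxp (hm k)) hxd
      by_cases he : x⁻¹ * d = 1
      · left
        have hxe : x = d := by
          have := mul_eq_one_iff_eq_inv.1 he
          simpa using this
        subst hxe
        have hk := hQ k (fun z hz hzd hzp => Γ.lel_trans (hdm z hz hzp hzd) hxp)
        have : leL Γ.P Γ.Δ (p k) := by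
          rcases le_total k j with h | h
          · obtain ⟨i, rfl⟩ := Nat.exists_eq_add_of_le h
            exact hk i _ Γ.Δ_mem hrefl hj
          · obtain ⟨i, rfl⟩ := Nat.exists_eq_add_of_le h
            exact hmono j hj i
        exact hmono k this 1
      · right
        refine ⟨d, hd, hdd, hdp, ?_⟩
        have h1 := Γ.norm_mul_ge x _ hx hxd'
        have h2 := Γ.norm_pos_of_ne _ hxd' he
        rw [mul_inv_cancel_left] at h1
        omega
  rcases key (Γ.norm Γ.Δ) with h | ⟨x, hx, hxd, hxp, hn⟩
  · exact h
  have h1 := Γ.norm_mul_ge x _ hx hxd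
  rw [mul_inv_cancel_left] at h1
  by_cases he : x⁻¹ * Γ.Δ = 1
  · have := mul_eq_one_iff_eq_inv.1 he
    rw [inv_inj] at this
    rwa [this] at hxp
  · have h2 := Γ.norm_pos_of_ne _ hxd he
    omega

theorem zsup_mul_le (x y : G) : Γ.zsup (x * y) ≤ Γ.zsup x + Γ.zsup y := by
  apply (Γ.zsup_spec (x * y)).2
  have h1 : x⁻¹ * Γ.Δ ^ Γ.zsup x ∈ Γ.P := (Γ.zsup_spec x).1
  have h2 : y⁻¹ * Γ.Δ ^ Γ.zsup y ∈ Γ.P := (Γ.zsup_spec y).1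
  have h3 := Γ.conj_zpow (-Γ.zsup y) _ h1
  have := Γ.P.mul_mem h2 h3
  change (x * y)⁻¹ * Γ.Δ ^ (Γ.zsup x + Γ.zsup y) ∈ Γ.P
  convert this using 1; group

theorem zsup_pow_le (x : G) (k : ℕ) : Γ.zsup (x ^ (k + 1)) ≤ (k + 1) * Γ.zsup x := by
  induction k with
  | zero => simp
  | succ k ih =>
    rw [pow_succ x (k + 1)]
    have := Γ.zsup_mul_le (x ^ (k + 1)) x
    push_cast
    linarith

theorem tsup_le (x : G) (k : ℕ) (hk : 1 ≤ k) : (k : ℝ) * Γ.tsup x ≤ Γ.zsup (x ^ k) := by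
  have hk0 : (0 : ℝ) < k := by exact_mod_cast hk
  have h := (Γ.tsup_spec x).comp
    ((tendsto_add_atTop_nat 1).const_mul_atTop' (show 0 < k by omega))
  rw [mul_comm, ← le_div_iff₀ hk0]
  refine le_of_tendsto h (Filter.Eventually.of_forall fun n => ?_)
  simp only [Function.comp]
  have h1 := Γ.zsup_pow_le (x ^ k) n
  rw [← pow_mul] at h1
  have h2 : ((Γ.zsup (x ^ (k * (n + 1))) : ℤ) : ℝ) ≤ (n + 1) * Γ.zsup (x ^ k) := by
    exact_mod_cast h1
  have hn : (0 : ℝ) < (n : ℝ) + 1 := by positivity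
  push_cast
  rw [div_le_div_iff₀ (by positivity) hk0]
  nlinarith

theorem straight_iff (g : G) :
    Γ.SupStraight g ↔ ∀ k : ℕ, 1 ≤ k → Γ.zsup (g ^ k) = (k : ℤ) * Γ.zsup g := by
  constructor
  · intro h k hk
    apply le_antisymm
    · obtain ⟨m, rfl⟩ := Nat.exists_eq_add_of_le' hk
      exact_mod_cast Γ.zsup_pow_le g m
    · have := Γ.tsup_le g k hk
      unfold SupStraight at h
      rw [← h] at this
      exact_mod_cast this
  · intro h
    refine tendsto_nhds_unique (tendsto_const_nhds.congr' ?_) (Γ.tsup_spec g)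
    filter_upwards [Filter.eventually_ge_atTop 1] with n hn
    rw [h n hn]
    have : (n : ℝ) ≠ 0 := by positivity
    push_cast
    field_simp

theorem Δ_ne_one : Γ.Δ ≠ 1 := by
  intro h
  have h1 := Γ.zsup_spec 1
  have : Γ.zsup 1 - 1 ∈ {s : ℤ | leL Γ.P 1 (Γ.Δ ^ s)} := by
    simp [h, leL, Γ.P.one_mem]
  have := h1.2 this
  omega

theorem of_norm (g : G) (h : Γ.zsup (g ^ Γ.norm Γ.Δ) = (Γ.norm Γ.Δ : ℤ) * Γ.zsup g)
    (k : ℕ) (hk : 1 ≤ k) : Γ.zsup (g ^ k) = (k : ℤ) * Γ.zsup g := by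
  by_contra hne
  have hle : Γ.zsup (g ^ k) ≤ (k : ℤ) * Γ.zsup g := by
    obtain ⟨m, rfl⟩ := Nat.exists_eq_add_of_le' hk
    exact_mod_cast Γ.zsup_pow_le g m
  have hlt : Γ.zsup (g ^ k) ≤ (k : ℤ) * Γ.zsup g - 1 := by omega
  set s := Γ.zsup g with hs
  have ha : g⁻¹ * Γ.Δ ^ s ∈ Γ.P := (Γ.zsup_spec g).1
  let p : ℕ → G := fun n => (g ^ n)⁻¹ * Γ.Δ ^ ((n : ℤ) * s)
  have hstep : ∀ n, p (n + 1) = (g⁻¹ * Γ.Δ ^ s) * (Γ.Δ ^ (-s) * p n * Γ.Δ ^ s) := by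
    intro n
    have e : ((n + 1 : ℕ) : ℤ) * s = n * s + s := by push_cast; ring
    simp only [p, e, pow_succ, zpow_add, mul_inv_rev, zpow_neg]
    group
  have hp : ∀ n, p n ∈ Γ.P := by
    intro n
    induction n with
    | zero => simp [p, Γ.P.one_mem]
    | succ n ih =>
      rw [hstep]
      refine Γ.P.mul_mem ha ?_
      simpa using Γ.conj_zpow (-s) _ ih
  have hm : ∀ n, leL Γ.P (p n) (p (n + 1)) := by
    intro n
    have := Γ.conj_zpow (-((n : ℤ) * s)) _ ha
    have e : ((n + 1 : ℕ) : ℤ) * s = s + n * s := by push_cast; ring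
    unfold leL
    convert this using 1
    simp only [p, e, pow_succ', zpow_add, mul_inv_rev, zpow_neg]
    simp only [← inv_pow, ← pow_succ, pow_succ']
    group
  have hj : leL Γ.P Γ.Δ (p k) := by
    have h1 : (g ^ k)⁻¹ * Γ.Δ ^ (Γ.zsup (g ^ k)) ∈ Γ.P := (Γ.zsup_spec (g ^ k)).1
    obtain ⟨m, hmm⟩ := Int.eq_ofNat_of_zero_le (sub_nonneg.2 hlt)
    have h2 := Γ.P.mul_mem h1 (Γ.P.pow_mem Γ.Δ_mem m)
    have h3 := Γ.conj_mem _ h2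
    have e : (k : ℤ) * s = Γ.zsup (g ^ k) + m + 1 := by omega
    unfold leL
    convert h3 using 1
    simp only [p, e, zpow_add, zpow_natCast, zpow_one]
    simp only [mul_assoc]
  have hN := Γ.main_div s _ ha p hp hstep hm k hj
  have : Γ.zsup (g ^ Γ.norm Γ.Δ) ≤ (Γ.norm Γ.Δ : ℤ) * s - 1 := by
    apply (Γ.zsup_spec _).2
    have h3 := Γ.conj_mem' _ hN
    change (g ^ Γ.norm Γ.Δ)⁻¹ * Γ.Δ ^ _ ∈ Γ.P
    convert h3 using 1
    simp only [p, zpow_sub, zpow_one]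
    group
  omega

end GarsideGroup

/-- `g` is sup-straight ⟺ `sup(g^N) = N·sup(g)` ⟺
`sup(g^k) = k·sup(g)` for all `k ≥ 1`. -/
theorem statement7 {G : Type*} [Group G] (Γ : GarsideGroup G) (g : G) :
    (Γ.SupStraight g ↔ Γ.zsup (g ^ Γ.norm Γ.Δ) = (Γ.norm Γ.Δ : ℤ) * Γ.zsup g) ∧
    (Γ.SupStraight g ↔ ∀ k : ℕ, 1 ≤ k → Γ.zsup (g ^ k) = (k : ℤ) * Γ.zsup g) := by
  refine ⟨⟨fun h => ?_, fun h => ?_⟩, Γ.straight_iff g⟩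
  · exact (Γ.straight_iff g).1 h _ (Γ.norm_pos_of_ne _ Γ.Δ_mem Γ.Δ_ne_one)
  · exact (Γ.straight_iff g).2 (Γ.of_norm g h)
end

section
/- Let G be a Garside group with Garside element Δ and N = ‖Δ‖. For every element g of G, the following are equivalent: (i) g is conjugate to an inf-straight element; (ii) inf_s(g) = t_inf(g); (iii) inf_s(g^N) = N·inf_s(g); (iv) inf_s(g^k) = k·inf_s(g) for every integer k ≥ 1; (v) every element h of the super summit set [g]^S is inf-straight. -/
open Filter Topology Pointwise

namespace GarsideGroup

section helpers

variable {G : Type*} [Group G] (Γ : GarsideGroup G)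

theorem aux_norm_add {a b : G} (ha : a ∈ Γ.P) (hb : b ∈ Γ.P) :
    Γ.norm a + Γ.norm b ≤ Γ.norm (a * b) := by
  obtain ⟨l, hl, hl1, hl2⟩ := (Γ.norm_spec a ha).1
  obtain ⟨m, hm, hm1, hm2⟩ := (Γ.norm_spec b hb).1
  refine (Γ.norm_spec (a * b) (Γ.P.mul_mem ha hb)).2 ⟨l ++ m, ?_, ?_, ?_⟩
  · simp [hl, hm]
  · intro x hx
    rcases List.mem_append.1 hx with h | h
    · exact hl1 x h
    · exact hm1 x h
  · simp [hl2, hm2]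

theorem aux_norm_zero {a : G} (ha : a ∈ Γ.P) (h : Γ.norm a = 0) : a = 1 := by
  obtain ⟨l, hl, hl1, hl2⟩ := (Γ.norm_spec a ha).1
  rw [h] at hl
  rw [List.length_eq_zero_iff] at hl
  subst hl
  simpa using hl2.symm

theorem aux_norm_one : Γ.norm 1 = 0 := by
  have := Γ.aux_norm_add Γ.P.one_mem Γ.P.one_mem
  rw [mul_one] at this
  omega

theorem aux_antisymm {a : G} (ha : a ∈ Γ.P) (ha' : a⁻¹ ∈ Γ.P) : a = 1 := by
  have := Γ.aux_norm_add ha ha'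
  rw [mul_inv_cancel, aux_norm_one] at this
  exact Γ.aux_norm_zero ha (by omega)

theorem le_refl' (a : G) : leL Γ.P a a := by
  simp [leL, Γ.P.one_mem]

theorem le_trans' {a b c : G} (h : leL Γ.P a b) (h' : leL Γ.P b c) : leL Γ.P a c := by
  unfold leL at *
  have := Γ.P.mul_mem h h'
  simpa [mul_assoc] using this

theorem le_antisymm' {a b : G} (h : leL Γ.P a b) (h' : leL Γ.P b a) : a = b := by
  unfold leL at *
  have := Γ.aux_antisymm h (by simpa using h')
  exact (inv_mul_eq_one.1 this)

theorem le_mul_left (c : G) {a b : G} (h : leL Γ.P a b) : leL Γ.P (c * a) (c * b) := by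
  unfold leL at *
  simpa [mul_assoc] using h

theorem norm_lt {a b : G} (ha : leL Γ.P 1 a) (h : leL Γ.P a b) (hne : a ≠ b) :
    Γ.norm a + 1 ≤ Γ.norm b := by
  unfold leL at *
  have ha' : a ∈ Γ.P := by simpa using ha
  have := Γ.aux_norm_add ha' h
  rw [mul_inv_cancel_left] at this
  have h0 : Γ.norm (a⁻¹ * b) ≠ 0 := fun h0 => hne (inv_mul_eq_one.1 (Γ.aux_norm_zero h h0))
  omega

theorem norm_mono {a b : G} (ha : leL Γ.P 1 a) (h : leL Γ.P a b) :
    Γ.norm a ≤ Γ.norm b := by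
  by_cases hne : a = b
  · rw [hne]
  · have := Γ.norm_lt ha h hne
    omega

theorem conj_Δ {a : G} (ha : a ∈ Γ.P) : Γ.Δ⁻¹ * a * Γ.Δ ∈ Γ.P := by
  rw [← Γ.simples_gen] at ha
  induction ha using Submonoid.closure_induction with
  | mem a h =>
    obtain ⟨h1, h2⟩ := h
    have h3 : leR Γ.P (a⁻¹ * Γ.Δ) Γ.Δ := by simpa [leR, mul_assoc] using h1
    have h4 := (Γ.Δ_balanced _ h2).2 h3
    simpa [leL, mul_assoc] using h4
  | one => simp [Γ.P.one_mem]
  | mul x y _ _ hx hy =>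
    have := Γ.P.mul_mem hx hy
    simpa [mul_assoc] using this

theorem conj_Δ' {a : G} (ha : a ∈ Γ.P) : Γ.Δ * a * Γ.Δ⁻¹ ∈ Γ.P := by
  rw [← Γ.simples_gen] at ha
  induction ha using Submonoid.closure_induction with
  | mem a h =>
    obtain ⟨h1, h2⟩ := h
    have h5 : Γ.Δ * a⁻¹ ∈ Γ.P := (Γ.Δ_balanced _ h1).1 h2
    have h3 : leL Γ.P (Γ.Δ * a⁻¹) Γ.Δ := by simpa [leL, mul_assoc] using h1
    have h4 := (Γ.Δ_balanced _ h5).1 h3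
    simpa [leR, mul_assoc] using h4
  | one => simp [Γ.P.one_mem]
  | mul x y _ _ hx hy =>
    have := Γ.P.mul_mem hx hy
    simpa [mul_assoc] using this

theorem conj_npow (n : ℕ) {a : G} (ha : a ∈ Γ.P) :
    (Γ.Δ ^ n)⁻¹ * a * Γ.Δ ^ n ∈ Γ.P ∧ Γ.Δ ^ n * a * (Γ.Δ ^ n)⁻¹ ∈ Γ.P := by
  induction n with
  | zero => simpa using ha
  | succ n ih =>
    constructor
    · have := Γ.conj_Δ ih.1
      simpa [pow_succ, mul_assoc] using this
    · have := Γ.conj_Δ' ih.2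
      simpa [pow_succ', mul_assoc] using this

theorem conj_zpow_s8 (n : ℤ) {a : G} (ha : a ∈ Γ.P) : (Γ.Δ ^ n)⁻¹ * a * Γ.Δ ^ n ∈ Γ.P := by
  obtain ⟨k, rfl | rfl⟩ := n.eq_nat_or_neg
  · simpa using (Γ.conj_npow k ha).1
  · simpa using (Γ.conj_npow k ha).2

theorem le_mul_right (n : ℤ) {a b : G} (h : leL Γ.P a b) :
    leL Γ.P (a * Γ.Δ ^ n) (b * Γ.Δ ^ n) := by
  unfold leL at *
  have := Γ.conj_zpow_s8 n h
  simpa [mul_assoc] using this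

theorem zpow_mono {m n : ℤ} (h : m ≤ n) : leL Γ.P (Γ.Δ ^ m) (Γ.Δ ^ n) := by
  obtain ⟨k, rfl⟩ := Int.le.dest h
  unfold leL
  rw [zpow_add]
  simpa using Γ.P.pow_mem Γ.Δ_mem k

theorem le_inf_iff {r : ℤ} {g : G} : r ≤ Γ.zinf g ↔ leL Γ.P (Γ.Δ ^ r) g :=
  ⟨fun h => Γ.le_trans' (Γ.zpow_mono h) (Γ.zinf_spec g).1, fun h => (Γ.zinf_spec g).2 h⟩

theorem sup_le_iff' {s : ℤ} {g : G} : Γ.zsup g ≤ s ↔ leL Γ.P g (Γ.Δ ^ s) :=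
  ⟨fun h => Γ.le_trans' (Γ.zsup_spec g).1 (Γ.zpow_mono h), fun h => (Γ.zsup_spec g).2 h⟩

theorem exists_lub (a b : G) : ∃ c, leL Γ.P a c ∧ leL Γ.P b c ∧
    ∀ d, leL Γ.P a d → leL Γ.P b d → leL Γ.P c d := by
  obtain ⟨r, hra, hrb⟩ : ∃ r, leL Γ.P (Γ.Δ ^ r) a ∧ leL Γ.P (Γ.Δ ^ r) b :=
    ⟨min (Γ.zinf a) (Γ.zinf b), Γ.le_inf_iff.1 (min_le_left _ _),
      Γ.le_inf_iff.1 (min_le_right _ _)⟩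
  obtain ⟨c, hc, h1, h2, h3⟩ := (Γ.latticeL _ hra _ hrb).2
  refine ⟨Γ.Δ ^ r * c, ?_, ?_, ?_⟩
  · simpa using Γ.le_mul_left (Γ.Δ ^ r) h1
  · simpa using Γ.le_mul_left (Γ.Δ ^ r) h2
  · intro d hd1 hd2
    have := h3 ((Γ.Δ ^ r)⁻¹ * d) (Γ.le_trans' hra hd1) (Γ.le_mul_left _ hd1) (Γ.le_mul_left _ hd2)
    simpa using Γ.le_mul_left (Γ.Δ ^ r) this

/-- The join for the left order. -/
noncomputable def join (a b : G) : G := (Γ.exists_lub a b).choose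

theorem le_join_left (a b : G) : leL Γ.P a (Γ.join a b) := (Γ.exists_lub a b).choose_spec.1
theorem le_join_right (a b : G) : leL Γ.P b (Γ.join a b) := (Γ.exists_lub a b).choose_spec.2.1
theorem join_le {a b d : G} (h : leL Γ.P a d) (h' : leL Γ.P b d) : leL Γ.P (Γ.join a b) d :=
  (Γ.exists_lub a b).choose_spec.2.2 d h h'

/-- The translation `x ↦ g⁻¹ x Δ^r`. -/
def tr (g : G) (r : ℤ) (x : G) : G := g⁻¹ * x * Γ.Δ ^ r

theorem tr_mono (g : G) (r : ℤ) {x y : G} (h : leL Γ.P x y) :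
    leL Γ.P (Γ.tr g r x) (Γ.tr g r y) :=
  Γ.le_mul_right r (Γ.le_mul_left _ h)

theorem tr_inv (g : G) (r : ℤ) (x : G) :
    Γ.tr g⁻¹ (-r) (Γ.tr g r x) = x ∧ Γ.tr g r (Γ.tr g⁻¹ (-r) x) = x := by
  simp [tr, mul_assoc]

theorem tr_le_iff (g : G) (r : ℤ) {x y : G} :
    leL Γ.P (Γ.tr g r x) y ↔ leL Γ.P x (Γ.tr g⁻¹ (-r) y) := by
  constructor
  · intro h
    have := Γ.tr_mono g⁻¹ (-r) h
    rwa [(Γ.tr_inv g r x).1] at this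
  · intro h
    have := Γ.tr_mono g r h
    rwa [(Γ.tr_inv g r y).2] at this

theorem tr_join_le (g : G) (r : ℤ) {x y z : G} (hx : leL Γ.P (Γ.tr g r x) z)
    (hy : leL Γ.P (Γ.tr g r y) z) : leL Γ.P (Γ.tr g r (Γ.join x y)) z := by
  rw [tr_le_iff] at *
  exact Γ.join_le hx hy

theorem tr_comm (g : G) (r s : ℤ) (x : G) :
    Γ.tr g r (Γ.tr g s x) = Γ.tr g s (Γ.tr g r x) := by
  simp only [tr, mul_assoc, ← zpow_add, add_comm]

theorem inf_conj_iff (g x : G) (r : ℤ) :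
    r ≤ Γ.zinf (x⁻¹ * g * x) ↔ leL Γ.P (Γ.tr g r x) x := by
  rw [le_inf_iff]
  simp [leL, tr, mul_assoc]

theorem sup_conj_iff (g x : G) (s : ℤ) :
    Γ.zsup (x⁻¹ * g * x) ≤ s ↔ leL Γ.P x (Γ.tr g s x) := by
  rw [sup_le_iff']
  simp [leL, tr, mul_assoc]

/-- ascending chain -/
noncomputable def chain (g : G) (r : ℤ) (x : G) : ℕ → G
  | 0 => x
  | n + 1 => Γ.join (chain g r x n) (Γ.tr g r (chain g r x n))

theorem exists_superSummit (g : G) : ∃ h, h ∈ Γ.superSummit g := by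
  obtain ⟨y0, hy0⟩ := (Γ.infs_spec g).1
  obtain ⟨x0, hx0⟩ := (Γ.sups_spec g).1
  simp only at hy0 hx0
  set r := Γ.infs g
  set s := Γ.sups g
  have hx : leL Γ.P x0 (Γ.tr g s x0) := (Γ.sup_conj_iff g x0 s).1 hx0.le
  have hy0' : leL Γ.P (Γ.tr g r y0) y0 := (Γ.inf_conj_iff g y0 r).1 hy0.ge
  -- shift y0 above x0
  obtain ⟨y, hy, hxy⟩ : ∃ y, leL Γ.P (Γ.tr g r y) y ∧ leL Γ.P x0 y := by
    refine ⟨y0 * Γ.Δ ^ (Γ.zsup (y0⁻¹ * x0)), ?_, ?_⟩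
    · have := Γ.le_mul_right (Γ.zsup (y0⁻¹ * x0)) hy0'
      simp only [tr, mul_assoc, ← zpow_add] at this ⊢
      rwa [add_comm] at this
    · have := (Γ.zsup_spec (y0⁻¹ * x0)).1
      simpa [mul_assoc] using Γ.le_mul_left y0 this
  have key : ∀ n, leL Γ.P x0 (Γ.chain g r x0 n) ∧ leL Γ.P (Γ.chain g r x0 n) y ∧
      leL Γ.P (Γ.chain g r x0 n) (Γ.tr g s (Γ.chain g r x0 n)) := by
    intro n
    induction n with
    | zero => exact ⟨Γ.le_refl' _, hxy, hx⟩
    | succ n ih =>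
      obtain ⟨h1, h2, h3⟩ := ih
      refine ⟨Γ.le_trans' h1 (Γ.le_join_left _ _),
        Γ.join_le h2 (Γ.le_trans' (Γ.tr_mono g r h2) hy), Γ.join_le ?_ ?_⟩
      · exact Γ.le_trans' h3 (Γ.tr_mono g s (Γ.le_join_left _ _))
      · refine Γ.le_trans' (Γ.tr_mono g r h3) ?_
        rw [tr_comm]
        exact Γ.tr_mono g s (Γ.le_join_right _ _)
  have key2 : ∃ n, leL Γ.P (Γ.tr g r (Γ.chain g r x0 n)) (Γ.chain g r x0 n) := by
    by_contra hcon
    push Not at hcon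
    have hn : ∀ n, n ≤ Γ.norm (x0⁻¹ * Γ.chain g r x0 n) := by
      intro n
      induction n with
      | zero => exact Nat.zero_le _
      | succ n ih =>
        have := Γ.norm_lt (a := x0⁻¹ * Γ.chain g r x0 n) (b := x0⁻¹ * Γ.chain g r x0 (n + 1))
          (by simpa using Γ.le_mul_left x0⁻¹ (key n).1)
          (Γ.le_mul_left _ (Γ.le_join_left _ _)) (by
            intro h
            have h := mul_left_cancel h
            apply hcon n
            have h4 := Γ.le_join_right (Γ.chain g r x0 n) (Γ.tr g r (Γ.chain g r x0 n))
            change leL Γ.P _ (Γ.chain g r x0 (n + 1)) at h4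
            rwa [← h] at h4)
        omega
    have h1 := hn (Γ.norm (x0⁻¹ * y) + 1)
    have h2 := Γ.norm_mono (a := x0⁻¹ * Γ.chain g r x0 (Γ.norm (x0⁻¹ * y) + 1))
      (b := x0⁻¹ * y) (by simpa using Γ.le_mul_left x0⁻¹ (key _).1)
      (Γ.le_mul_left _ (key _).2.1)
    omega
  obtain ⟨n, hn⟩ := key2
  set z := Γ.chain g r x0 n
  refine ⟨z⁻¹ * g * z, ⟨z, rfl⟩, le_antisymm ?_ ?_, le_antisymm ?_ ?_⟩
  · exact (Γ.infs_spec g).2 ⟨z, rfl⟩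
  · exact (Γ.inf_conj_iff g z r).2 hn
  · exact (Γ.sup_conj_iff g z s).2 (key n).2.2
  · exact (Γ.sups_spec g).2 ⟨z, rfl⟩

theorem tr_pow (g : G) (r : ℤ) (k : ℕ) (x : G) :
    Γ.tr (g ^ (k + 1)) (r * (k + 1 : ℕ)) x = Γ.tr g r (Γ.tr (g ^ k) (r * k) x) := by
  have : r * ((k + 1 : ℕ) : ℤ) = r * k + r := by push_cast; ring
  rw [this]
  simp only [tr, zpow_add, pow_succ, mul_inv_rev, mul_assoc]

theorem inf_pow_iff (g : G) (r : ℤ) (k : ℕ) :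
    r * k + 1 ≤ Γ.zinf (g ^ k) ↔ leL Γ.P (Γ.tr (g ^ k) (r * k) Γ.Δ) 1 := by
  rw [le_inf_iff, add_comm, zpow_add]
  simp [leL, tr, mul_assoc]

theorem inf_pow_N (g : G) (r : ℤ) (hr : r ≤ Γ.zinf g) (m : ℕ)
    (hm : r * m + 1 ≤ Γ.zinf (g ^ m)) :
    r * (Γ.norm Γ.Δ : ℕ) + 1 ≤ Γ.zinf (g ^ Γ.norm Γ.Δ) := by
  rw [inf_pow_iff] at *
  set N := Γ.norm Γ.Δ
  set y : ℕ → G := fun k => Γ.tr (g ^ k) (r * k) Γ.Δ with hy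
  set x : ℕ → G := fun k => Γ.join 1 (y k) with hx
  have hyS : ∀ k, y (k + 1) = Γ.tr g r (y k) := fun k => Γ.tr_pow g r k Γ.Δ
  have hy0 : y 0 = Γ.Δ := by simp [hy, tr]
  have h1 : leL Γ.P (Γ.tr g r 1) 1 := (Γ.inf_conj_iff g 1 r).1 (by simpa using hr)
  have hΔ : leL Γ.P (Γ.tr g r Γ.Δ) Γ.Δ := by
    have := Γ.le_mul_right 1 h1
    simp only [tr, mul_assoc, ← zpow_add, mul_one, one_mul, zpow_one] at this ⊢
    rw [← zpow_add_one, add_comm, zpow_add, zpow_one] at this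
    exact this
  have hdec : ∀ k, leL Γ.P (y (k + 1)) (y k) := by
    intro k
    induction k with
    | zero => rw [hyS, hy0]; exact hΔ
    | succ k ih => rw [hyS (k + 1), hyS k]; rw [hyS k] at ih; exact Γ.tr_mono g r ih
  have hxdec : ∀ k, leL Γ.P (x (k + 1)) (x k) := fun k =>
    Γ.join_le (Γ.le_join_left _ _) (Γ.le_trans' (hdec k) (Γ.le_join_right _ _))
  have hxS : ∀ k, x (k + 1) = Γ.join 1 (Γ.tr g r (x k)) := by
    intro k
    apply Γ.le_antisymm'
    · refine Γ.join_le (Γ.le_join_left _ _) ?_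
      rw [hyS]
      exact Γ.le_trans' (Γ.tr_mono g r (Γ.le_join_right _ _)) (Γ.le_join_right _ _)
    · refine Γ.join_le (Γ.le_join_left _ _) (Γ.tr_join_le g r ?_ ?_)
      · exact Γ.le_trans' h1 (Γ.le_join_left _ _)
      · rw [← hyS]; exact Γ.le_join_right _ _
  have hge : ∀ k, leL Γ.P 1 (x k) := fun k => Γ.le_join_left _ _
  have hxm : x m = 1 := Γ.le_antisymm' (Γ.join_le (Γ.le_refl' _) hm) (hge m)
  have hanti : ∀ k j, leL Γ.P (x (k + j)) (x k) := by
    intro k j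
    induction j with
    | zero => exact Γ.le_refl' _
    | succ j ih => exact Γ.le_trans' (hxdec (k + j)) ih
  have hstab : ∀ k, x (k + 1) = x k → x k = 1 := by
    intro k hk
    have hc : ∀ j, x (k + j) = x k := by
      intro j
      induction j with
      | zero => rfl
      | succ j ih => rw [← add_assoc, hxS, ih, ← hxS, hk]
    have h2 := hanti m k
    rw [add_comm, hc m, hxm] at h2
    exact Γ.le_antisymm' h2 (hge k)
  have hcl : ∀ k, x k = 1 ∨ Γ.norm (x k) + k ≤ N := by
    intro k
    induction k with
    | zero =>
      right
      refine Γ.norm_mono (hge 0) (Γ.join_le ?_ ?_)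
      · simpa [leL] using Γ.Δ_mem
      · rw [hy0]; exact Γ.le_refl' _
    | succ k ih =>
      by_cases he : x (k + 1) = x k
      · left; rw [he]; exact hstab k he
      · rcases ih with ih | ih
        · left
          have := hxdec k
          rw [ih] at this
          exact Γ.le_antisymm' this (hge _)
        · right
          have := Γ.norm_lt (hge _) (hxdec k) he
          omega
  have hN : x N = 1 := by
    rcases hcl N with h | h
    · exact h
    · exact Γ.aux_norm_zero (by simpa [leL] using hge N) (by omega)
  have := Γ.le_join_right 1 (y N)
  change leL Γ.P (y N) (x N) at this
  rwa [hN] at this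

theorem inf_mul (a b : G) : Γ.zinf a + Γ.zinf b ≤ Γ.zinf (a * b) := by
  rw [le_inf_iff, zpow_add]
  exact Γ.le_trans' (Γ.le_mul_right _ (Γ.zinf_spec a).1) (Γ.le_mul_left _ (Γ.zinf_spec b).1)

theorem inf_pow (g : G) (n : ℕ) : (n : ℤ) * Γ.zinf g ≤ Γ.zinf (g ^ n) := by
  induction n with
  | zero => rw [le_inf_iff]; simp [leL, Γ.P.one_mem]
  | succ n ih =>
    have := Γ.inf_mul (g ^ n) g
    rw [pow_succ]
    push_cast
    linarith

theorem inf_le_tinf (g : G) : (Γ.zinf g : ℝ) ≤ Γ.tinf g := by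
  refine ge_of_tendsto (Γ.tinf_spec g) ?_
  filter_upwards [eventually_gt_atTop 0] with n hn
  rw [le_div_iff₀ (by exact_mod_cast hn), mul_comm]
  exact_mod_cast Γ.inf_pow g n

theorem conj_pow' (g x : G) (n : ℕ) : (x⁻¹ * g * x) ^ n = x⁻¹ * g ^ n * x := by
  simpa using conj_pow (i := n) (a := x⁻¹) (b := g)

theorem tinf_le_conj (g x : G) : Γ.tinf g ≤ Γ.tinf (x⁻¹ * g * x) := by
  have h1 := (Γ.tinf_spec g).add
    (tendsto_const_div_atTop_nhds_zero_nat ((Γ.zinf x⁻¹ + Γ.zinf x : ℤ) : ℝ))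
  rw [add_zero] at h1
  refine le_of_tendsto_of_tendsto' h1 (Γ.tinf_spec _) ?_
  intro n
  rw [← add_div]
  refine div_le_div_of_nonneg_right ?_ (Nat.cast_nonneg n)
  rw [conj_pow']
  have h2 := Γ.inf_mul (x⁻¹ * g ^ n) x
  have h3 := Γ.inf_mul x⁻¹ (g ^ n)
  have : Γ.zinf (g ^ n) + (Γ.zinf x⁻¹ + Γ.zinf x) ≤ Γ.zinf (x⁻¹ * g ^ n * x) := by linarith
  exact_mod_cast this

theorem tinf_conj (g x : G) : Γ.tinf (x⁻¹ * g * x) = Γ.tinf g := by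
  refine le_antisymm ?_ (Γ.tinf_le_conj g x)
  have := Γ.tinf_le_conj (x⁻¹ * g * x) x⁻¹
  simpa [mul_assoc] using this

theorem infs_le_tinf (g : G) : (Γ.infs g : ℝ) ≤ Γ.tinf g := by
  obtain ⟨x, hx⟩ := (Γ.infs_spec g).1
  simp only at hx
  rw [← hx, ← Γ.tinf_conj g x]
  exact Γ.inf_le_tinf _

theorem tinf_pow (g : G) (k : ℕ) (hk : 1 ≤ k) : Γ.tinf (g ^ k) = k * Γ.tinf g := by
  have hk0 : (k : ℝ) ≠ 0 := by positivity
  have h1 : Tendsto (fun n : ℕ => k * n) atTop atTop :=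
    tendsto_id.const_mul_atTop' (by omega)
  have h2 := ((Γ.tinf_spec g).comp h1).const_mul (k : ℝ)
  refine tendsto_nhds_unique (Γ.tinf_spec (g ^ k)) (h2.congr ?_)
  intro n
  simp only [Function.comp, pow_mul, Nat.cast_mul]
  by_cases hn : (n : ℝ) = 0
  · simp [hn]
  · field_simp

theorem infs_pow (g : G) (k : ℕ) : (k : ℤ) * Γ.infs g ≤ Γ.infs (g ^ k) := by
  obtain ⟨x, hx⟩ := (Γ.infs_spec g).1
  simp only at hx
  have h1 := Γ.inf_pow (x⁻¹ * g * x) k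
  rw [hx, conj_pow'] at h1
  exact h1.trans ((Γ.infs_spec (g ^ k)).2 ⟨x, rfl⟩)

theorem norm_Δ_pos : 1 ≤ Γ.norm Γ.Δ := by
  by_contra h
  have h1 : Γ.Δ = 1 := Γ.aux_norm_zero Γ.Δ_mem (by omega)
  have h2 : Γ.zinf 1 + 1 ≤ Γ.zinf 1 := by
    rw [le_inf_iff, h1]; simp [leL, Γ.P.one_mem]
  omega

theorem iii_ii (g : G) (h : Γ.infs (g ^ Γ.norm Γ.Δ) = (Γ.norm Γ.Δ : ℤ) * Γ.infs g) :
    (Γ.infs g : ℝ) = Γ.tinf g := by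
  refine le_antisymm (Γ.infs_le_tinf g) ?_
  by_contra hlt
  push Not at hlt
  obtain ⟨x, hx⟩ := (Γ.infs_spec g).1
  simp only at hx
  rw [← Γ.tinf_conj g x] at hlt
  obtain ⟨m, hm, hm0⟩ := (((Γ.tinf_spec (x⁻¹ * g * x)).eventually_const_lt hlt).and
    (eventually_gt_atTop 0)).exists
  rw [lt_div_iff₀ (by exact_mod_cast hm0)] at hm
  have hm' : Γ.infs g * m < Γ.zinf ((x⁻¹ * g * x) ^ m) := by exact_mod_cast hm
  have h1 := Γ.inf_pow_N _ _ hx.ge m hm'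
  rw [conj_pow'] at h1
  have h2 := (Γ.infs_spec (g ^ Γ.norm Γ.Δ)).2 ⟨x, rfl⟩
  simp only at h2
  rw [h] at h2
  linarith

end helpers

end GarsideGroup

/-- the following are equivalent: (i) `g` is conjugate to an inf-straight
element; (ii) `inf_s(g) = t_inf(g)`; (iii) `inf_s(g^N) = N·inf_s(g)`;
(iv) `inf_s(g^k) = k·inf_s(g)` for all `k ≥ 1`; (v) every `h ∈ [g]^S` is inf-straight. -/
theorem statement8 {G : Type*} [Group G] (Γ : GarsideGroup G) (g : G) :
    ((∃ x : G, Γ.InfStraight (x⁻¹ * g * x)) ↔ (Γ.infs g : ℝ) = Γ.tinf g) ∧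
    (((Γ.infs g : ℝ) = Γ.tinf g) ↔
      Γ.infs (g ^ Γ.norm Γ.Δ) = (Γ.norm Γ.Δ : ℤ) * Γ.infs g) ∧
    ((Γ.infs (g ^ Γ.norm Γ.Δ) = (Γ.norm Γ.Δ : ℤ) * Γ.infs g) ↔
      ∀ k : ℕ, 1 ≤ k → Γ.infs (g ^ k) = (k : ℤ) * Γ.infs g) ∧
    ((∀ k : ℕ, 1 ≤ k → Γ.infs (g ^ k) = (k : ℤ) * Γ.infs g) ↔
      ∀ h ∈ Γ.superSummit g, Γ.InfStraight h) := by
  have i_ii : (∃ x : G, Γ.InfStraight (x⁻¹ * g * x)) → (Γ.infs g : ℝ) = Γ.tinf g := by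
    rintro ⟨x, hx⟩
    refine le_antisymm (Γ.infs_le_tinf g) ?_
    unfold GarsideGroup.InfStraight at hx
    rw [Γ.tinf_conj] at hx
    rw [← hx]
    exact_mod_cast (Γ.infs_spec g).2 ⟨x, rfl⟩
  have ii_i : (Γ.infs g : ℝ) = Γ.tinf g → ∃ x : G, Γ.InfStraight (x⁻¹ * g * x) := by
    intro h
    obtain ⟨x, hx⟩ := (Γ.infs_spec g).1
    simp only at hx
    refine ⟨x, ?_⟩
    unfold GarsideGroup.InfStraight
    rw [hx, Γ.tinf_conj, h]
  have ii_iv : (Γ.infs g : ℝ) = Γ.tinf g →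
      ∀ k : ℕ, 1 ≤ k → Γ.infs (g ^ k) = (k : ℤ) * Γ.infs g := by
    intro h k hk
    refine le_antisymm ?_ (Γ.infs_pow g k)
    have h1 := Γ.infs_le_tinf (g ^ k)
    rw [Γ.tinf_pow g k hk, ← h] at h1
    exact_mod_cast h1
  have iv_iii : (∀ k : ℕ, 1 ≤ k → Γ.infs (g ^ k) = (k : ℤ) * Γ.infs g) →
      Γ.infs (g ^ Γ.norm Γ.Δ) = (Γ.norm Γ.Δ : ℤ) * Γ.infs g :=
    fun h => h _ Γ.norm_Δ_pos
  have iii_ii := Γ.iii_ii g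
  have ii_v : (Γ.infs g : ℝ) = Γ.tinf g → ∀ h ∈ Γ.superSummit g, Γ.InfStraight h := by
    rintro h _ ⟨⟨x, rfl⟩, h1, -⟩
    unfold GarsideGroup.InfStraight
    rw [h1, Γ.tinf_conj, h]
  have v_i : (∀ h ∈ Γ.superSummit g, Γ.InfStraight h) →
      ∃ x : G, Γ.InfStraight (x⁻¹ * g * x) := by
    intro h
    obtain ⟨z, hz⟩ := Γ.exists_superSummit g
    obtain ⟨⟨x, rfl⟩, -⟩ := id hz
    exact ⟨x, h _ hz⟩
  exact ⟨⟨i_ii, ii_i⟩, ⟨fun h => iv_iii (ii_iv h), iii_ii⟩,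
    ⟨fun h => ii_iv (iii_ii h), iv_iii⟩,
    ⟨fun h => ii_v (iii_ii (iv_iii h)), fun h => ii_iv (i_ii (v_i h))⟩⟩
end
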